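/- Suppose (A1) and (A2) hold. Fix α ∈ (0,π] and w ∈ (0,π/(2α)). Suppose there exist p₀ > 0 and A₀, C ∈ (0,∞) such that for all x ∈ W(α) ∩ S with ‖x‖ ≥ A₀, E[f_w(ξ_{t+1})^{2p₀/w} − f_w(ξ_t)^{2p₀/w} | ξ_t = x] ≤ −C f_w(x)^{(2p₀−2)/w}. Then for any p ∈ [0,p₀) and any x ∈ W(α), E[τ_α^p | ξ₀ = x] < ∞. -/

import Mathlib

open MeasureTheory
open scoped ENNReal

noncomputable section

/-- Euclidean norm of a lattice point in `ℤ²`. -/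
def znorm (x : ℤ × ℤ) : ℝ := Real.sqrt ((x.1 : ℝ) ^ 2 + (x.2 : ℝ) ^ 2)

/-- Polar angle in `(-π, π]` of a lattice point. -/
def ang (x : ℤ × ℤ) : ℝ := Complex.arg ⟨(x.1 : ℝ), (x.2 : ℝ)⟩

/-- The harmonic function `f_w(x) = r^w cos(w φ)` in polar coordinates. -/
def fw (w : ℝ) (x : ℤ × ℤ) : ℝ := znorm x ^ w * Real.cos (w * ang x)

/-- First component of the mean drift at `x` given jump pmf `p`. -/
def mu1 (p : ℤ × ℤ → ℤ × ℤ → ℝ) (x : ℤ × ℤ) : ℝ := ∑' y : ℤ × ℤ, p x y * (y.1 : ℝ)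

/-- Second component of the mean drift at `x`. -/
def mu2 (p : ℤ × ℤ → ℤ × ℤ → ℝ) (x : ℤ × ℤ) : ℝ := ∑' y : ℤ × ℤ, p x y * (y.2 : ℝ)

/-- Euclidean norm of the mean drift at `x`. -/
def muNorm (p : ℤ × ℤ → ℤ × ℤ → ℝ) (x : ℤ × ℤ) : ℝ :=
  Real.sqrt (mu1 p x ^ 2 + mu2 p x ^ 2)

/-- Second moment `M₁₁(x)`. -/
def M11 (p : ℤ × ℤ → ℤ × ℤ → ℝ) (x : ℤ × ℤ) : ℝ := ∑' y : ℤ × ℤ, p x y * (y.1 : ℝ) ^ 2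

/-- Second moment `M₂₂(x)`. -/
def M22 (p : ℤ × ℤ → ℤ × ℤ → ℝ) (x : ℤ × ℤ) : ℝ := ∑' y : ℤ × ℤ, p x y * (y.2 : ℝ) ^ 2

/-- Mixed second moment `M₁₂(x)`. -/
def M12 (p : ℤ × ℤ → ℤ × ℤ → ℝ) (x : ℤ × ℤ) : ℝ :=
  ∑' y : ℤ × ℤ, p x y * ((y.1 : ℝ) * (y.2 : ℝ))

/-- `p` is a family of probability mass functions on `ℤ²` (the jump laws `θ(x)`). -/
def IsJumpPMF (p : ℤ × ℤ → ℤ × ℤ → ℝ) : Prop :=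
  (∀ x y, 0 ≤ p x y) ∧ ∀ x, HasSum (p x) 1

/-- (A2): jumps are uniformly bounded by `b`: `P[‖θ(x)‖ > b] = 0` for all `x`. -/
def A2 (p : ℤ × ℤ → ℤ × ℤ → ℝ) (b : ℝ) : Prop :=
  ∀ x y, b < znorm y → p x y = 0

section walk

variable {Ω : Type*} [MeasurableSpace Ω]

/-- `ξ` is a time-homogeneous Markov chain with one-step jump law `p`:
conditionally on the past and on `ξ_t = x`, the law of `ξ_{t+1} - ξ_t` is `p x`. -/
def IsMarkovWith (P : Measure Ω) (ξ : ℕ → Ω → ℤ × ℤ) (p : ℤ × ℤ → ℤ × ℤ → ℝ) : Prop :=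
  ∀ (t : ℕ) (x y : ℤ × ℤ) (A : Set Ω),
    MeasurableSet[⨆ s ∈ Finset.range (t + 1), MeasurableSpace.comap (ξ s) ⊤] A →
    P (A ∩ {ω | ξ t ω = x} ∩ {ω | ξ (t + 1) ω = x + y}) =
      ENNReal.ofReal (p x y) * P (A ∩ {ω | ξ t ω = x})

/-- (A1): uniform weak isotropy: from any `x ∈ S`, in `n₀` steps the walk moves by
each of `±k e₁, ±k e₂` with conditional probability at least `κ`. -/
def A1 (P : Measure Ω) (S : Set (ℤ × ℤ)) (ξ : ℕ → Ω → ℤ × ℤ)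
    (κ : ℝ) (k n₀ : ℕ) : Prop :=
  ∀ (t : ℕ), ∀ x ∈ S,
    ∀ y ∈ ({((k : ℤ), (0 : ℤ)), (-(k : ℤ), 0), (0, (k : ℤ)), (0, -(k : ℤ))} : Set (ℤ × ℤ)),
      ENNReal.ofReal κ * P {ω | ξ t ω = x} ≤
        P ({ω | ξ t ω = x} ∩ {ω | ξ (t + n₀) ω = x + y})

/-- First exit time from a region `Wm`, with value `∞` if the walk never leaves. -/
def exitTime (Wm : Set (ℤ × ℤ)) (ξ : ℕ → Ω → ℤ × ℤ) (ω : Ω) : ℝ≥0∞ :=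
  ⨅ (t : ℕ) (_ : ξ t ω ∉ Wm), (t : ℝ≥0∞)

end walk

/-- The wedge `W(α)` for `α ∈ (0,π)`, together with the `α = π` case, where
`W(π) = ℝ² \ H_b` is the complement of the thickened half-line of half-width `b`. -/
def Wset (b α : ℝ) : Set (ℤ × ℤ) :=
  {x | (α < Real.pi ∧ znorm x * Real.cos α < (x.1 : ℝ)) ∨
       (α = Real.pi ∧ ¬ ((x.1 : ℝ) ≤ 0 ∧ |(x.2 : ℝ)| ≤ b))}

/-- The wedge `W(α) = {x : r > 0, -α < φ < α}` in polar form, for `α ∈ (0,π]`. -/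
def WsetArg (α : ℝ) : Set (ℤ × ℤ) :=
  {x | 0 < znorm x ∧ -α < ang x ∧ ang x < α}

end


/-- Shifted powers `v ↦ (v ^ (1 / p) + s) ^ p`, with `p ≥ 1`, lie below their tangent lines
(written in the variable `u = v ^ (1 / p)`). -/
theorem add_rpow_le_tangent {p u u' s : ℝ} (hp : 1 ≤ p) (hu : 0 < u) (hu' : 0 ≤ u')
    (hs : 0 ≤ s) :
    (u' + s) ^ p ≤ (u + s) ^ p + ((u + s) / u) ^ (p - 1) * (u' ^ p - u ^ p) := by
  have hus : 0 < u + s := by positivity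
  have key := (convexOn_rpow hp).2 (Set.mem_Ici.2 (show 0 ≤ u' / u by positivity))
    (Set.mem_Ici.2 zero_le_one) (show 0 ≤ u / (u + s) by positivity)
    (show 0 ≤ s / (u + s) by positivity) (by field_simp)
  simp only [smul_eq_mul, Real.one_rpow, mul_one] at key
  have e1 : u / (u + s) * (u' / u) + s / (u + s) = (u' + s) / (u + s) := by field_simp
  rw [e1, Real.div_rpow (by positivity) hus.le, Real.div_rpow hu' hu.le,
    div_le_iff₀ (by positivity)] at key
  refine key.trans (le_of_eq ?_)
  rw [Real.div_rpow hus.le hu.le, Real.rpow_sub_one hus.ne', Real.rpow_sub_one hu.ne']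
  have := (Real.rpow_pos_of_pos hus p).ne'
  have := (Real.rpow_pos_of_pos hu p).ne'
  field_simp
  ring

theorem sub_mul_rpow_le_rpow_sub {p a ε : ℝ} (hp : 1 ≤ p) (ha : 0 < a) (hε : ε ≤ a) :
    a ^ p - p * ε * a ^ (p - 1) ≤ (a - ε) ^ p := by
  have h := one_add_mul_self_le_rpow_one_add (s := -ε / a)
    (by rw [le_div_iff₀ ha]; linarith) hp
  have e : 1 + -ε / a = (a - ε) / a := by field_simp; ring
  rw [e, Real.div_rpow (by linarith) ha.le, le_div_iff₀ (by positivity)] at h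
  rw [Real.rpow_sub_one ha.ne']
  refine le_trans (le_of_eq ?_) h
  field_simp
  ring

section operator

variable {X : Type*} {E : Set X} {T : (X → ℝ) →ₗ[ℝ] (X → ℝ)}

theorem pow_apply_le_of_forall_mem
    (hmono : ∀ f g : X → ℝ, (∀ z ∈ E, f z ≤ g z) → ∀ x, T f x ≤ T g x)
    {f g : X → ℝ} (hfg : ∀ z ∈ E, f z ≤ g z) (n : ℕ) {x : X} (hx : x ∈ E) :
    (T ^ n) f x ≤ (T ^ n) g x := by
  induction n generalizing x with
  | zero => simpa using hfg x hx
  | succ n ih =>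
    rw [pow_succ', Module.End.mul_apply, Module.End.mul_apply]
    exact hmono _ _ (fun z hz => ih hz) x

theorem pow_apply_nonneg (hmono : ∀ f g : X → ℝ, (∀ z ∈ E, f z ≤ g z) → ∀ x, T f x ≤ T g x)
    {f : X → ℝ} (hf : ∀ z ∈ E, 0 ≤ f z) (n : ℕ) {x : X} (hx : x ∈ E) :
    0 ≤ (T ^ n) f x := by
  simpa using pow_apply_le_of_forall_mem hmono (f := 0) hf n hx

theorem pow_one_antitone (hmono : ∀ f g : X → ℝ, (∀ z ∈ E, f z ≤ g z) → ∀ x, T f x ≤ T g x)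
    (hone : ∀ x, T 1 x ≤ 1) {x : X} (hx : x ∈ E) : Antitone fun n => (T ^ n) 1 x := by
  refine antitone_nat_of_succ_le fun n => ?_
  rw [pow_succ, Module.End.mul_apply]
  exact pow_apply_le_of_forall_mem hmono (fun z _ => hone z) n hx

/-- Polynomial tail bound from the drift condition with exponent `p ≥ 1`. -/
theorem tail_le_of_drift_of_one_le
    (hmono : ∀ f g : X → ℝ, (∀ z ∈ E, f z ≤ g z) → ∀ x, T f x ≤ T g x)
    (hone : ∀ x, T 1 x ≤ 1) {V : X → ℝ} {c p : ℝ} (hp : 1 ≤ p) (hc : 0 < c)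
    (hV : ∀ x ∈ E, 0 < V x) (hT : ∀ x ∈ E, T V x ≤ V x - c * V x ^ (1 - 1 / p))
    {x : X} (hx : x ∈ E) {n : ℕ} (hn : 0 < n) :
    (T ^ n) 1 x ≤ V x * (c / p) ^ (-p) * (n : ℝ) ^ (-p) := by
  have hp0 : 0 < p := by linarith
  set ε := c / p with hε
  have hε0 : 0 < ε := by positivity
  let g : ℝ → X → ℝ := fun s x => (V x ^ (1 / p) + s) ^ p
  have step : ∀ s, 0 ≤ s → ∀ x ∈ E, T (g (s + ε)) x ≤ g s x := by
    intro s hs x hx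
    set u := V x ^ (1 / p) with hu
    have hVx := hV x hx
    have hu0 : 0 < u := by positivity
    have hup : u ^ p = V x := by rw [hu, ← Real.rpow_mul hVx.le]; field_simp; simp
    have hup1 : u ^ (p - 1) = V x ^ (1 - 1 / p) := by
      rw [hu, ← Real.rpow_mul hVx.le]; congr 1; field_simp
    set σ := s + ε with hσ
    have hσ0 : 0 < σ := by positivity
    set A := ((u + σ) / u) ^ (p - 1) with hA
    have hA0 : 0 < A := by positivity
    have hAu : A * u ^ (p - 1) = (u + σ) ^ (p - 1) := by
      rw [hA, ← Real.mul_rpow (by positivity) hu0.le]; congr 1; field_simp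
    have hAV : A * V x = (u + σ) ^ (p - 1) * u := by
      rw [← hAu, mul_assoc, ← hup]; congr 1
      rw [Real.rpow_sub_one hu0.ne']; field_simp
    have hpow : (u + σ) ^ p = (u + σ) ^ (p - 1) * (u + σ) := by
      rw [Real.rpow_sub_one (by positivity)]; field_simp
    have ha0 : 0 ≤ (u + σ) ^ p - A * V x := by
      rw [hAV, hpow, ← mul_sub]; ring_nf; positivity
    have hle := hmono (g σ) (((u + σ) ^ p - A * V x) • (1 : X → ℝ) + A • V) (fun z hz => by
      have hVz := hV z hz
      have := add_rpow_le_tangent hp hu0 (u' := V z ^ (1 / p)) (by positivity) hσ0.le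
      rw [hup, ← Real.rpow_mul hVz.le, one_div, inv_mul_cancel₀ hp0.ne', Real.rpow_one,
        ← one_div] at this
      simp only [Pi.add_apply, Pi.smul_apply, Pi.one_apply, smul_eq_mul, g]
      linarith) x
    rw [map_add, map_smul, map_smul] at hle
    simp only [Pi.add_apply, Pi.smul_apply, smul_eq_mul] at hle
    have h1 := mul_le_mul_of_nonneg_left (hone x) ha0
    have h2 := mul_le_mul_of_nonneg_left (hT x hx) hA0.le
    have h3 := sub_mul_rpow_le_rpow_sub hp (a := u + σ) (ε := ε) (by positivity)
      (by linarith)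
    have h4 : u + σ - ε = u + s := by rw [hσ]; ring
    have h5 : p * ε = c := by rw [hε]; field_simp
    rw [h4, h5] at h3
    have h6 : A * (V x - c * V x ^ (1 - 1 / p)) = A * V x - c * (u + σ) ^ (p - 1) := by
      rw [← hAu, hup1]; ring
    show T (g σ) x ≤ (u + s) ^ p
    linarith
  have iter : ∀ n : ℕ, ∀ s, 0 ≤ s → ∀ x ∈ E, (T ^ n) (g (s + n * ε)) x ≤ g s x := by
    intro n
    induction n with
    | zero => intro s _ x _; simp
    | succ n ih =>
      intro s hs x hx
      rw [pow_succ', Module.End.mul_apply]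
      refine le_trans (hmono _ (g (s + ε)) (fun z hz => ?_) x) (step s hs x hx)
      have := ih (s + ε) (by positivity) z hz
      convert this using 3
      push_cast; ring
  have hn' : (0 : ℝ) < n := by exact_mod_cast hn
  have h := iter n 0 le_rfl x hx
  have hg : g 0 x = V x := by
    simp only [g, add_zero]
    rw [← Real.rpow_mul (hV x hx).le]; field_simp; simp
  have hlow := pow_apply_le_of_forall_mem hmono (f := ((n * ε : ℝ) ^ p) • (1 : X → ℝ))
    (g := g (0 + n * ε)) (fun z hz => by
      have := hV z hz
      simp only [Pi.smul_apply, Pi.one_apply, smul_eq_mul, mul_one, g, zero_add]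
      gcongr
      have : 0 ≤ V z ^ (1 / p) := by positivity
      linarith) n hx
  rw [map_smul, Pi.smul_apply, smul_eq_mul] at hlow
  rw [mul_assoc, ← Real.mul_rpow hε0.le hn'.le, Real.rpow_neg (by positivity), ← div_eq_mul_inv,
    le_div_iff₀ (by positivity), mul_comm ε]
  linarith

/-- Polynomial tail bound from the drift condition with exponent `p ≤ 1`. -/
theorem tail_le_of_drift_of_le_one
    (hmono : ∀ f g : X → ℝ, (∀ z ∈ E, f z ≤ g z) → ∀ x, T f x ≤ T g x)
    (hone : ∀ x, T 1 x ≤ 1) {V : X → ℝ} {c p : ℝ} (hp0 : 0 < p) (hp : p ≤ 1) (hc : 0 < c)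
    (hV : ∀ x ∈ E, 0 < V x) (hT : ∀ x ∈ E, T V x ≤ V x - c * V x ^ (1 - 1 / p))
    {x : X} (hx : x ∈ E) {N : ℕ} (hN : 0 < N) :
    (T ^ N) 1 x ≤ V x * (1 + 1 / c) * (N : ℝ) ^ (-p) := by
  have hN' : (0 : ℝ) < N := by exact_mod_cast hN
  set L : ℝ := (N : ℝ) ^ p with hL
  have hL0 : 0 < L := by positivity
  set m : X → ℝ := fun z => min (V z) L with hm
  set κ : ℝ := c * (N : ℝ) ^ (p - 1) with hκ
  have hκ0 : 0 < κ := by positivity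
  have hm0 : ∀ z ∈ E, 0 < m z := fun z hz => lt_min (hV z hz) hL0
  have hTm : ∀ z ∈ E, (1 : X → ℝ) z ≤ (L⁻¹ • m + κ⁻¹ • (m - T m)) z := by
    intro z hz
    simp only [Pi.one_apply, Pi.add_apply, Pi.smul_apply, smul_eq_mul, Pi.sub_apply]
    by_cases hVL : V z < L
    · have h1 : T m z ≤ V z - κ := by
        refine (hmono m V (fun _ _ => min_le_left _ _) z).trans ((hT z hz).trans ?_)
        have : (N : ℝ) ^ (p - 1) ≤ V z ^ (1 - 1 / p) := by
          have e : (N : ℝ) ^ (p - 1) = L ^ (1 - 1 / p) := by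
            rw [hL, ← Real.rpow_mul hN'.le]; congr 1; field_simp
          rw [e]
          refine Real.rpow_le_rpow_of_nonpos (hV z hz) hVL.le ?_
          rw [sub_nonpos, le_div_iff₀ hp0]; linarith
        have := mul_le_mul_of_nonneg_left this hc.le
        linarith
      have h2 : m z = V z := min_eq_left hVL.le
      have h3 : 1 ≤ κ⁻¹ * (m z - T m z) := by
        rw [← div_eq_inv_mul, le_div_iff₀ hκ0]; linarith
      have := hm0 z hz
      have : 0 ≤ L⁻¹ * m z := by positivity
      linarith
    · have h2 : m z = L := min_eq_right (not_lt.1 hVL)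
      have h1 : T m z ≤ L := by
        have := hmono m (L • (1 : X → ℝ)) (fun y _ => by simp [m]) z
        rw [map_smul, Pi.smul_apply, smul_eq_mul] at this
        exact this.trans (mul_le_of_le_one_right hL0.le (hone z))
      have h3 : 0 ≤ κ⁻¹ * (m z - T m z) := mul_nonneg (by positivity) (by linarith)
      rw [h2] at h3 ⊢
      rw [inv_mul_cancel₀ hL0.ne']
      linarith
  have hTm' : ∀ z ∈ E, T m z ≤ m z := by
    intro z hz
    refine le_min ?_ ?_
    · refine (hmono m V (fun _ _ => min_le_left _ _) z).trans ((hT z hz).trans ?_)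
      have := hV z hz
      have : 0 ≤ c * V z ^ (1 - 1 / p) := by positivity
      linarith
    · have := hmono m (L • (1 : X → ℝ)) (fun y _ => by simp [m]) z
      rw [map_smul, Pi.smul_apply, smul_eq_mul] at this
      exact this.trans (mul_le_of_le_one_right hL0.le (hone z))
  have hiter : ∀ n, (T ^ n) m x ≤ m x := by
    intro n
    induction n with
    | zero => simp
    | succ n ih =>
      rw [pow_succ, Module.End.mul_apply]
      exact (pow_apply_le_of_forall_mem hmono hTm' n hx).trans ih
  have hsum : (N : ℝ) * (T ^ N) 1 x ≤ N * (L⁻¹ * m x) + κ⁻¹ * (m x - (T ^ N) m x) := by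
    have hb : ∀ n ∈ Finset.range N,
        (T ^ N) 1 x ≤ L⁻¹ * m x + κ⁻¹ * ((T ^ n) m x - (T ^ (n + 1)) m x) := by
      intro n hn
      refine (pow_one_antitone hmono hone hx (Finset.mem_range.1 hn).le).trans ?_
      refine (pow_apply_le_of_forall_mem hmono hTm n hx).trans ?_
      rw [map_add, map_smul, map_smul, map_sub, pow_succ, Module.End.mul_apply]
      simp only [Pi.add_apply, Pi.smul_apply, smul_eq_mul, Pi.sub_apply]
      gcongr
      exact hiter n
    have h := Finset.sum_le_sum hb
    rw [Finset.sum_add_distrib, ← Finset.mul_sum _ _ κ⁻¹, Finset.sum_range_sub'] at h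
    simpa using h
  have hmV : m x ≤ V x := min_le_left _ _
  have hmN : 0 ≤ (T ^ N) m x := pow_apply_nonneg hmono (fun z hz => (hm0 z hz).le) N hx
  have h1 : (N : ℝ) * (T ^ N) 1 x ≤ N * (L⁻¹ * V x) + κ⁻¹ * V x := by
    refine hsum.trans ?_
    gcongr
    linarith
  have e1 : κ⁻¹ = c⁻¹ * (N * L⁻¹) := by
    rw [hκ, hL, Real.rpow_sub_one hN'.ne']; field_simp
  rw [Real.rpow_neg hN'.le, ← hL]
  rw [e1] at h1
  have : (N : ℝ) * (T ^ N) 1 x ≤ N * (V x * (1 + 1 / c) * L⁻¹) := by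
    refine h1.trans (le_of_eq ?_)
    field_simp
  exact le_of_mul_le_mul_left this hN'

/-- Polynomial tail bound from a polynomial drift condition. -/
theorem exists_tail_le_of_drift
    (hmono : ∀ f g : X → ℝ, (∀ z ∈ E, f z ≤ g z) → ∀ x, T f x ≤ T g x)
    (hone : ∀ x, T 1 x ≤ 1) {V : X → ℝ} {c p : ℝ} (hp : 0 < p) (hc : 0 < c)
    (hV : ∀ x ∈ E, 0 < V x) (hT : ∀ x ∈ E, T V x ≤ V x - c * V x ^ (1 - 1 / p))
    {x : X} (hx : x ∈ E) :
    ∃ D : ℝ, ∀ n : ℕ, 0 < n → (T ^ n) 1 x ≤ D * (n : ℝ) ^ (-p) := by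
  rcases le_total p 1 with h | h
  · exact ⟨_, fun n hn => tail_le_of_drift_of_le_one hmono hone hp h hc hV hT hx hn⟩
  · exact ⟨_, fun n hn => tail_le_of_drift_of_one_le hmono hone h hc hV hT hx hn⟩

/-- Polynomial tail bound from a polynomial drift condition that may fail on a finite set `K`,
provided the killed dynamics can leave `E` from every point of `K`. -/
theorem exists_tail_le_of_drift_off_finite
    (hmono : ∀ f g : X → ℝ, (∀ z ∈ E, f z ≤ g z) → ∀ x, T f x ≤ T g x)
    (hone : ∀ x, T 1 x ≤ 1) {V : X → ℝ} {c v p : ℝ} (hp : 0 < p) (hc : 0 < c) (hv : 0 < v)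
    {K : Set X} (hK : K.Finite) (hKE : K ⊆ E)
    (hexit : ∀ x ∈ K, ∃ m : ℕ, (T ^ m) 1 x < 1)
    (hV : ∀ x ∈ E, 0 ≤ V x) (hVK : ∀ x ∈ E, x ∉ K → v ≤ V x)
    (hT : ∀ x ∈ E, x ∉ K → T V x ≤ V x - c * V x ^ (1 - 1 / p))
    {x : X} (hx : x ∈ E) :
    ∃ D : ℝ, ∀ n : ℕ, 0 < n → (T ^ n) 1 x ≤ D * (n : ℝ) ^ (-p) := by
  obtain ⟨M, hM⟩ : ∃ M : ℕ, ∀ x ∈ K, (T ^ M) 1 x < 1 := by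
    choose! m hm using hexit
    obtain ⟨M, hM⟩ := (hK.image m).bddAbove
    refine ⟨M, fun x hx => (pow_one_antitone hmono hone (hKE hx) (hM ⟨x, hx, rfl⟩)).trans_lt
      (hm x hx)⟩
  obtain ⟨a, ha1, ha⟩ : ∃ a : ℝ, a < 1 ∧ ∀ x ∈ K, (T ^ M) 1 x ≤ a := by
    rcases K.eq_empty_or_nonempty with rfl | hne
    · exact ⟨0, by norm_num, by simp⟩
    · obtain ⟨y, hy, hmax⟩ := K.exists_max_image (fun x => (T ^ M) 1 x) hK hne
      exact ⟨_, hM y hy, hmax⟩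
  obtain ⟨B, hB⟩ : ∃ B : ℝ, ∀ x ∈ K, T V x - V x ≤ B := by
    obtain ⟨B, hB⟩ := (hK.image fun x => T V x - V x).bddAbove
    exact ⟨B, fun x hx => hB ⟨x, hx, rfl⟩⟩
  have hδ : 0 < 1 - a := by linarith
  set ψ : X → ℝ := (1 - a)⁻¹ • ∑ i ∈ Finset.range M, (T ^ i) 1 with hψ
  have hψ0 : ∀ z ∈ E, 0 ≤ ψ z := by
    intro z hz
    simp only [hψ, Pi.smul_apply, Finset.sum_apply, smul_eq_mul]
    exact mul_nonneg (by positivity)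
      (Finset.sum_nonneg fun i _ => pow_apply_nonneg hmono (by simp) i hz)
  have hψM : ∀ z ∈ E, ψ z ≤ (1 - a)⁻¹ * M := by
    intro z hz
    simp only [hψ, Pi.smul_apply, Finset.sum_apply, smul_eq_mul]
    gcongr
    refine (Finset.sum_le_card_nsmul _ _ 1 fun i _ => ?_).trans (by simp)
    simpa using pow_one_antitone hmono hone hz (Nat.zero_le i)
  have hψT : ∀ z, T ψ z = ψ z - (1 - a)⁻¹ * (1 - (T ^ M) 1 z) := by
    intro z
    have h := Finset.sum_range_sub' (fun i => (T ^ i) 1 z) M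
    simp only [hψ, map_smul, map_sum, Pi.smul_apply, Finset.sum_apply, smul_eq_mul]
    rw [← mul_sub]
    simp only [pow_zero, Module.End.one_apply, Pi.one_apply] at h
    rw [← h, Finset.sum_sub_distrib, sub_sub_cancel]
    simp only [pow_succ', Module.End.mul_apply]
  have hψE : ∀ z ∈ E, T ψ z ≤ ψ z := by
    intro z hz
    have h1 : (T ^ M) 1 z ≤ 1 := by simpa using pow_one_antitone hmono hone hz (Nat.zero_le M)
    have : 0 ≤ (1 - a)⁻¹ * (1 - (T ^ M) 1 z) := mul_nonneg (by positivity) (by linarith)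
    rw [hψT]; linarith
  have hψK : ∀ z ∈ K, T ψ z ≤ ψ z - 1 := by
    intro z hz
    have : 1 ≤ (1 - a)⁻¹ * (1 - (T ^ M) 1 z) := by
      rw [← div_eq_inv_mul, le_div_iff₀ hδ]; linarith [ha z hz]
    rw [hψT]; linarith
  set Λ : ℝ := max B 0 + 1 with hΛ
  have hΛ0 : 0 < Λ := by positivity
  have hΛB : B + 1 ≤ Λ := by rw [hΛ]; gcongr; exact le_max_left _ _
  set U : X → ℝ := V + Λ • ψ + 1 with hU
  set e : ℝ := 1 - 1 / p with he
  have hUT : ∀ z, T U z ≤ T V z + Λ * T ψ z + 1 := by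
    intro z
    simp only [hU, map_add, map_smul, Pi.add_apply, Pi.smul_apply, smul_eq_mul]
    gcongr
    exact hone z
  have hUz : ∀ z, U z = V z + Λ * ψ z + 1 := fun z => by simp [hU]
  have hVU : ∀ z ∈ E, V z ≤ U z := by
    intro z hz
    have := mul_nonneg hΛ0.le (hψ0 z hz)
    rw [hUz]; linarith
  have hU0 : ∀ z ∈ E, 0 < U z := by
    intro z hz
    have := mul_nonneg hΛ0.le (hψ0 z hz)
    rw [hUz]; linarith [hV z hz]
  set G : ℝ := Λ * ((1 - a)⁻¹ * M) + 1 with hG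
  have hG0 : 0 < G := by positivity
  set R : ℝ := (1 + G / v) ^ |e| with hR
  have hR0 : 0 < R := by positivity
  have hR1 : 1 ≤ R := Real.one_le_rpow (by linarith [div_pos hG0 hv]) (abs_nonneg e)
  have hcomp : ∀ z ∈ E, z ∉ K → U z ^ e ≤ R * V z ^ e := by
    intro z hz hzK
    have hvz := hVK z hz hzK
    have hVz : 0 < V z := hv.trans_le hvz
    rcases le_total e 0 with h0 | h0
    · refine (Real.rpow_le_rpow_of_nonpos hVz (hVU z hz) h0).trans ?_
      exact le_mul_of_one_le_left (by positivity) hR1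
    · rw [hR, abs_of_nonneg h0, ← Real.mul_rpow (by positivity) hVz.le]
      refine Real.rpow_le_rpow (hU0 z hz).le ?_ h0
      have h1 := mul_le_mul_of_nonneg_left (hψM z hz) hΛ0.le
      have h2 : G ≤ G / v * V z := by
        rw [div_mul_eq_mul_div, le_div_iff₀ hv]; gcongr
      rw [hUz]; linarith
  obtain ⟨D, hD⟩ : ∃ D : ℝ, ∀ z ∈ K, U z ^ e ≤ D := by
    obtain ⟨D, hD⟩ := (hK.image fun z => U z ^ e).bddAbove
    exact ⟨D, fun z hz => hD ⟨z, hz, rfl⟩⟩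
  have hD0 : 0 < max D 1 := by positivity
  refine exists_tail_le_of_drift (c := min (c / R) (1 / max D 1)) hmono hone hp
    (by positivity) hU0 (fun z hz => ?_) hx
  have hUe : 0 < U z ^ e := Real.rpow_pos_of_pos (hU0 z hz) e
  by_cases hzK : z ∈ K
  · have h1 : min (c / R) (1 / max D 1) * U z ^ e ≤ 1 := by
      refine (mul_le_mul_of_nonneg_right (min_le_right _ _) hUe.le).trans ?_
      rw [one_div, ← div_eq_inv_mul, div_le_one hD0]
      exact (hD z hzK).trans (le_max_left _ _)
    have h2 := mul_le_mul_of_nonneg_left (hψK z hzK) hΛ0.le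
    have h3 := hUT z
    have h4 := hB z hzK
    rw [hUz z] at h1 ⊢
    linarith
  · have h1 : min (c / R) (1 / max D 1) * U z ^ e ≤ c * V z ^ e := by
      refine (mul_le_mul_of_nonneg_right (min_le_left _ _) hUe.le).trans ?_
      refine (mul_le_mul_of_nonneg_left (hcomp z hz hzK) (by positivity)).trans (le_of_eq ?_)
      field_simp
    have h2 := mul_le_mul_of_nonneg_left (hψE z hz) hΛ0.le
    have h3 := hUT z
    have h4 := hT z hz hzK
    rw [hUz z] at h1 ⊢
    linarith

end operator
section moments

theorem rpow_le_one_add_tsum_indicator {Ω : Type*} {q : ℝ} (hq : 0 ≤ q) (τ : Ω → ℝ≥0∞) (ω : Ω) :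
    τ ω ^ q ≤ 1 + ∑' j : ℕ, {ω | ((2 ^ j : ℕ) : ℝ≥0∞) < τ ω}.indicator
      (fun _ => ENNReal.ofReal (((2 : ℝ) ^ (j + 1)) ^ q)) ω := by
  by_cases htop : τ ω = ⊤
  · have : ∑' j : ℕ, {ω | ((2 ^ j : ℕ) : ℝ≥0∞) < τ ω}.indicator
      (fun _ => ENNReal.ofReal (((2 : ℝ) ^ (j + 1)) ^ q)) ω = ⊤ := by
      refine top_unique ?_
      rw [← ENNReal.tsum_const_eq_top_of_ne_zero (α := ℕ) one_ne_zero]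
      refine ENNReal.tsum_le_tsum fun j => ?_
      have hmem : ω ∈ {ω | ((2 ^ j : ℕ) : ℝ≥0∞) < τ ω} := by
        simp only [Set.mem_ofPred_eq, htop]; exact ENNReal.natCast_lt_top _
      rw [Set.indicator_of_mem hmem, ENNReal.one_le_ofReal]
      exact Real.one_le_rpow (one_le_pow₀ one_le_two) hq
    rw [this]; simp
  · have hex : ∃ J : ℕ, τ ω ≤ ((2 ^ J : ℕ) : ℝ≥0∞) := by
      obtain ⟨n, hn⟩ := ENNReal.exists_nat_gt htop
      exact ⟨n, hn.le.trans (by exact_mod_cast Nat.lt_two_pow_self.le)⟩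
    classical
    obtain ⟨J, hJ, hmin⟩ : ∃ J : ℕ, τ ω ≤ ((2 ^ J : ℕ) : ℝ≥0∞) ∧
        ∀ i < J, ¬ τ ω ≤ ((2 ^ i : ℕ) : ℝ≥0∞) :=
      ⟨Nat.find hex, Nat.find_spec hex, fun i hi => Nat.find_min hex hi⟩
    rcases J with _ | j
    · refine le_trans ?_ le_self_add
      exact ENNReal.rpow_le_one (by simpa using hJ) hq
    · refine le_trans ?_ le_add_self
      refine le_trans ?_ (ENNReal.le_tsum j)
      have hmem : ω ∈ {ω | ((2 ^ j : ℕ) : ℝ≥0∞) < τ ω} := not_le.1 (hmin j j.lt_succ_self)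
      rw [Set.indicator_of_mem hmem, ← ENNReal.ofReal_rpow_of_nonneg (by positivity) hq]
      refine ENNReal.rpow_le_rpow (hJ.trans (le_of_eq ?_)) hq
      rw [ENNReal.ofReal_pow (by norm_num)]
      push_cast
      simp

theorem lintegral_rpow_lt_top_of_tail_le {Ω : Type*} [MeasurableSpace Ω] {ν : Measure Ω}
    [IsFiniteMeasure ν] {τ : Ω → ℝ≥0∞}
    (hτ : ∀ n : ℕ, MeasurableSet {ω | (n : ℝ≥0∞) < τ ω}) {D p q : ℝ} (hq : 0 ≤ q) (hqp : q < p)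
    (htail : ∀ n : ℕ, 0 < n → ν {ω | (n : ℝ≥0∞) < τ ω} ≤ ENNReal.ofReal (D * (n : ℝ) ^ (-p))) :
    ∫⁻ ω, τ ω ^ q ∂ν < ⊤ := by
  refine (lintegral_mono (rpow_le_one_add_tsum_indicator hq τ)).trans_lt ?_
  rw [lintegral_add_left measurable_const, lintegral_const, one_mul,
    lintegral_tsum fun j => (measurable_const.indicator (hτ _)).aemeasurable]
  refine ENNReal.add_lt_top.2 ⟨measure_lt_top _ _, ?_⟩
  have hterm : ∀ j : ℕ, ∫⁻ ω, {ω | ((2 ^ j : ℕ) : ℝ≥0∞) < τ ω}.indicator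
      (fun _ => ENNReal.ofReal (((2 : ℝ) ^ (j + 1)) ^ q)) ω ∂ν ≤
      ENNReal.ofReal (2 ^ q * D * ((2 : ℝ) ^ (q - p)) ^ j) := by
    intro j
    rw [lintegral_indicator_const (hτ _)]
    refine (mul_le_mul_right (htail (2 ^ j) (by positivity)) _).trans (le_of_eq ?_)
    rw [← ENNReal.ofReal_mul (by positivity)]
    congr 1
    push_cast
    rw [← Real.rpow_natCast 2 (j + 1), ← Real.rpow_natCast 2 j,
      ← Real.rpow_natCast (2 ^ (q - p)) j, ← Real.rpow_mul two_pos.le, ← Real.rpow_mul two_pos.le,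
      ← Real.rpow_mul two_pos.le, mul_left_comm, ← Real.rpow_add two_pos, mul_comm (2 ^ q) D,
      mul_assoc, ← Real.rpow_add two_pos]
    push_cast
    ring_nf
  refine (ENNReal.tsum_le_tsum hterm).trans_lt ?_
  have hs : Summable fun j : ℕ => 2 ^ q * D * ((2 : ℝ) ^ (q - p)) ^ j :=
    (summable_geometric_of_lt_one (by positivity)
      (Real.rpow_lt_one_of_one_lt_of_neg one_lt_two (by linarith))).mul_left _
  exact hs.tsum_ofReal_lt_top

end moments

section killed

/-- One step of the walk with jump law `p`, with jumps in `F`, killed on leaving `E`. -/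
noncomputable def killedStep (p : ℤ × ℤ → ℤ × ℤ → ℝ) (F : Finset (ℤ × ℤ)) (E : Set (ℤ × ℤ)) :
    (ℤ × ℤ → ℝ) →ₗ[ℝ] (ℤ × ℤ → ℝ) where
  toFun h x := ∑ y ∈ F, p x y * E.indicator h (x + y)
  map_add' f g := by
    ext x
    simp only [Set.indicator_add', Pi.add_apply, mul_add, Finset.sum_add_distrib]
  map_smul' c f := by
    ext x
    simp only [Pi.smul_apply, smul_eq_mul, RingHom.id_apply,
      Finset.mul_sum]
    exact Finset.sum_congr rfl fun y _ => by
      by_cases h : x + y ∈ E <;> simp [h]; ring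

variable {p : ℤ × ℤ → ℤ × ℤ → ℝ} {F : Finset (ℤ × ℤ)} {E : Set (ℤ × ℤ)}

theorem killedStep_apply (h : ℤ × ℤ → ℝ) (x : ℤ × ℤ) :
    killedStep p F E h x = ∑ y ∈ F, p x y * E.indicator h (x + y) := rfl

theorem killedStep_mono (hp : ∀ x y, 0 ≤ p x y) (f g : ℤ × ℤ → ℝ) (hfg : ∀ z ∈ E, f z ≤ g z)
    (x : ℤ × ℤ) : killedStep p F E f x ≤ killedStep p F E g x := by
  refine Finset.sum_le_sum fun y _ => mul_le_mul_of_nonneg_left ?_ (hp x y)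
  exact Set.indicator_le_indicator' (hfg _)

theorem killedStep_one_le (hp : ∀ x y, 0 ≤ p x y) (hF : ∀ x, ∑ y ∈ F, p x y = 1) (x : ℤ × ℤ) :
    killedStep p F E 1 x ≤ 1 := by
  rw [← hF x]
  refine Finset.sum_le_sum fun y _ => mul_le_of_le_one_right (hp x y) ?_
  exact Set.indicator_le_self' (by simp) _

theorem exists_killedStep_pow_one_lt_one (hp : ∀ x y, 0 ≤ p x y) (hF : ∀ x, ∑ y ∈ F, p x y = 1)
    (hpF : ∀ x y, y ∉ F → p x y = 0) {x z : ℤ × ℤ} (hz : z ∉ E)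
    (hxz : Relation.ReflTransGen (fun a c => 0 < p a (c - a)) x z) (hx : x ∈ E) :
    ∃ m : ℕ, (killedStep p F E ^ m) 1 x < 1 := by
  suffices ∃ m : ℕ, E.indicator ((killedStep p F E ^ m) 1) x < 1 by
    obtain ⟨m, hm⟩ := this
    exact ⟨m, by rwa [Set.indicator_of_mem hx] at hm⟩
  clear hx
  induction hxz using Relation.ReflTransGen.head_induction_on with
  | refl => exact ⟨0, by simp [hz]⟩
  | @head a c hac _ ih =>
    obtain ⟨m, hm⟩ := ih
    refine ⟨m + 1, ?_⟩
    by_cases ha : a ∈ E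
    · rw [Set.indicator_of_mem ha, pow_succ', Module.End.mul_apply, killedStep_apply, ← hF a]
      refine Finset.sum_lt_sum (fun y _ => mul_le_of_le_one_right (hp a y) ?_)
        ⟨c - a, ?_, ?_⟩
      · refine Set.indicator_apply_le' (fun h => ?_) fun _ => zero_le_one
        simpa using pow_one_antitone (killedStep_mono hp) (killedStep_one_le hp hF) h
          (Nat.zero_le m)
      · by_contra h
        exact hac.ne' (hpF a _ h)
      · rw [add_sub_cancel]
        exact mul_lt_of_lt_one_right hac hm
    · simp [ha]

end killed

section geometry

theorem znorm_eq_norm (x : ℤ × ℤ) : znorm x = ‖(⟨x.1, x.2⟩ : ℂ)‖ := by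
  rw [Complex.norm_eq_sqrt_sq_add_sq]; rfl

theorem znorm_nonneg (x : ℤ × ℤ) : 0 ≤ znorm x := Real.sqrt_nonneg _

theorem abs_fst_le_znorm (x : ℤ × ℤ) : |(x.1 : ℝ)| ≤ znorm x := by
  rw [znorm_eq_norm]; exact Complex.abs_re_le_norm ⟨x.1, x.2⟩

theorem abs_snd_le_znorm (x : ℤ × ℤ) : |(x.2 : ℝ)| ≤ znorm x := by
  rw [znorm_eq_norm]; exact Complex.abs_im_le_norm ⟨x.1, x.2⟩

theorem znorm_le_abs_add_abs (x : ℤ × ℤ) : znorm x ≤ |(x.1 : ℝ)| + |(x.2 : ℝ)| := by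
  rw [znorm_eq_norm]; exact Complex.norm_le_abs_re_add_abs_im ⟨x.1, x.2⟩

theorem abs_znorm_add_sub_le (x y : ℤ × ℤ) : |znorm (x + y) - znorm x| ≤ znorm y := by
  simp only [znorm_eq_norm]
  have h := abs_norm_sub_norm_le (⟨(x + y).1, (x + y).2⟩ : ℂ) ⟨x.1, x.2⟩
  have e : (⟨(x + y).1, (x + y).2⟩ : ℂ) - ⟨x.1, x.2⟩ = ⟨y.1, y.2⟩ := by
    apply Complex.ext <;> simp
  rwa [e] at h

theorem znorm_mul_cos_ang (x : ℤ × ℤ) : znorm x * Real.cos (ang x) = x.1 := by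
  rw [znorm_eq_norm]; exact Complex.norm_mul_cos_arg ⟨x.1, x.2⟩

theorem finite_znorm_le (r : ℝ) : {x : ℤ × ℤ | znorm x ≤ r}.Finite := by
  refine (Set.finite_Icc ((-⌈r⌉, -⌈r⌉) : ℤ × ℤ) (⌈r⌉, ⌈r⌉)).subset fun x hx => ?_
  have hx : znorm x ≤ r := hx
  have h1 := abs_le.1 ((abs_fst_le_znorm x).trans (hx.trans (Int.le_ceil r)))
  have h2 := abs_le.1 ((abs_snd_le_znorm x).trans (hx.trans (Int.le_ceil r)))
  refine ⟨⟨?_, ?_⟩, ⟨?_, ?_⟩⟩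
  · exact_mod_cast h1.1
  · exact_mod_cast h2.1
  · exact_mod_cast h1.2
  · exact_mod_cast h2.2

theorem abs_ang_le {x : ℤ × ℤ} {β : ℝ} (hβ : 0 ≤ β) (hx : 0 < znorm x)
    (h : znorm x * Real.cos β ≤ x.1) : |ang x| ≤ β := by
  rw [← znorm_mul_cos_ang] at h
  by_contra! hlt
  have hcos := Real.cos_lt_cos_of_nonneg_of_le_pi hβ (Complex.abs_arg_le_pi ⟨x.1, x.2⟩) hlt
  rw [show |Complex.arg ⟨x.1, x.2⟩| = |ang x| from rfl, Real.cos_abs] at hcos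
  exact absurd (le_of_mul_le_mul_left h hx) (not_le.2 hcos)

theorem znorm_pos_of_mem_Wset {b α : ℝ} (hb : 0 < b) {x : ℤ × ℤ} (hx : x ∈ Wset b α) :
    0 < znorm x := by
  refine (znorm_nonneg x).lt_of_ne' fun h0 => ?_
  have h1 := abs_fst_le_znorm x
  have h2 := abs_snd_le_znorm x
  rw [h0] at h1 h2
  rcases hx with ⟨_, h⟩ | ⟨_, h⟩
  · rw [h0, zero_mul] at h
    exact absurd ((le_abs_self _).trans h1) (not_le.2 h)
  · exact h ⟨(le_abs_self _).trans h1, h2.trans hb.le⟩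

theorem abs_ang_le_of_mem_Wset {b α : ℝ} (hb : 0 < b) (hα : 0 < α) {x : ℤ × ℤ}
    (hx : x ∈ Wset b α) : |ang x| ≤ α := by
  have h0 := znorm_pos_of_mem_Wset hb hx
  rcases hx with ⟨_, h⟩ | ⟨h, _⟩
  · exact abs_ang_le hα.le h0 h.le
  · rw [h]; exact Complex.abs_arg_le_pi _

theorem znorm_rpow_mul_cos_le_fw {b α w : ℝ} (hb : 0 < b) (hα : 0 < α) (hw0 : 0 < w)
    (hw : w * α < Real.pi / 2) {x : ℤ × ℤ} (hx : x ∈ Wset b α) :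
    znorm x ^ w * Real.cos (w * α) ≤ fw w x := by
  unfold fw
  refine mul_le_mul_of_nonneg_left ?_ (Real.rpow_nonneg (znorm_nonneg x) _)
  rw [← Real.cos_abs (w * ang x), abs_mul, abs_of_pos hw0]
  refine Real.cos_le_cos_of_nonneg_of_le_pi (by positivity) (by linarith [Real.pi_pos]) ?_
  gcongr
  exact abs_ang_le_of_mem_Wset hb hα hx

theorem fw_nonneg_of_abs_ang_le {w : ℝ} (hw : 0 < w) {x : ℤ × ℤ}
    (h : |ang x| ≤ Real.pi / (2 * w)) : 0 ≤ fw w x := by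
  refine mul_nonneg (Real.rpow_nonneg (znorm_nonneg x) _) ?_
  rw [← Real.cos_abs, abs_mul, abs_of_pos hw]
  refine Real.cos_nonneg_of_neg_pi_div_two_le_of_le ?_ ?_
  · have := Real.pi_pos
    have : 0 ≤ w * |ang x| := by positivity
    linarith
  · refine (mul_le_mul_of_nonneg_left h hw.le).trans (le_of_eq ?_)
    field_simp

/-- Far from the origin, bounded jumps from the wedge stay in the region where `f_w ≥ 0`. -/
theorem exists_forall_fw_add_nonneg {b α w : ℝ} (hb : 0 < b) (hα : 0 < α)
    (hw0 : 0 < w) (hw : w * α < Real.pi / 2) :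
    ∃ A : ℝ, ∀ x ∈ Wset b α, A ≤ znorm x → ∀ y, znorm y ≤ b → 0 ≤ fw w (x + y) := by
  have hαw : α < Real.pi / (2 * w) := by
    rw [lt_div_iff₀ (by positivity)]; linarith
  rcases le_or_gt Real.pi (Real.pi / (2 * w)) with hπ | hπ
  · exact ⟨0, fun x _ _ y _ => fw_nonneg_of_abs_ang_le hw0
      ((Complex.abs_arg_le_pi _).trans hπ)⟩
  · set β := Real.pi / (2 * w) with hβ
    have hcos : Real.cos β < Real.cos α :=
      Real.cos_lt_cos_of_nonneg_of_le_pi hα.le hπ.le hαw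
    refine ⟨max (2 * b / (Real.cos α - Real.cos β)) (2 * b), fun x hx hA y hy => ?_⟩
    have hd : 0 < Real.cos α - Real.cos β := by linarith
    have h1 := (le_max_left _ _).trans hA
    have h2 := (le_max_right _ _).trans hA
    rw [div_le_iff₀ hd] at h1
    have h3 := abs_le.1 ((abs_znorm_add_sub_le x y).trans hy)
    have h4 := abs_le.1 ((abs_fst_le_znorm y).trans hy)
    rcases hx with ⟨_, h⟩ | ⟨h, _⟩
    · refine fw_nonneg_of_abs_ang_le hw0 (abs_ang_le (by linarith) (by linarith) ?_)
      rw [Prod.fst_add, Int.cast_add]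
      have h5 : (znorm (x + y) - znorm x) * Real.cos β ≤ b := by
        refine (le_abs_self _).trans ?_
        rw [abs_mul]
        refine (mul_le_of_le_one_right (abs_nonneg _) (Real.abs_cos_le_one β)).trans ?_
        exact abs_le.2 h3
      linarith [h4.1]
    · linarith

theorem exists_sub_notMem_Wset {b α : ℝ} (hα : 0 < α) (hαπ : α < Real.pi) {k : ℕ} (hk : 0 < k)
    (x : ℤ × ℤ) : ∃ m : ℕ, x - ((m * k : ℤ), 0) ∉ Wset b α := by
  have hc : -1 < Real.cos α := by
    rw [← Real.cos_pi]
    exact Real.cos_lt_cos_of_nonneg_of_le_pi hα.le le_rfl hαπ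
  obtain ⟨m, hm⟩ := exists_nat_gt (|(x.1 : ℝ)| + |(x.2 : ℝ)| / (1 + Real.cos α))
  refine ⟨m, fun hmem => ?_⟩
  rcases hmem with ⟨_, h⟩ | ⟨h, _⟩
  · have hk' : (1 : ℝ) ≤ k := by exact_mod_cast hk
    have hmk : (m : ℝ) ≤ m * k := le_mul_of_one_le_right (by positivity) hk'
    have h1 := le_abs_self (x.1 : ℝ)
    have hc' : 0 < 1 + Real.cos α := by linarith
    set X : ℝ := x.1 - m * k with hX
    have h2 : X ≤ -(|(x.2 : ℝ)| / (1 + Real.cos α)) := by linarith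
    have h0 : 0 ≤ |(x.2 : ℝ)| / (1 + Real.cos α) := by positivity
    have h3 := znorm_le_abs_add_abs (x - ((m * k : ℤ), 0))
    have h4 := znorm_nonneg (x - ((m * k : ℤ), 0))
    simp only [Prod.fst_sub, Prod.snd_sub, sub_zero] at h h3
    push_cast at h h3
    rw [← hX] at h h3
    rw [abs_of_nonpos (by linarith)] at h3
    have h5 : |(x.2 : ℝ)| ≤ -X * (1 + Real.cos α) := by
      rw [← div_le_iff₀ hc']; linarith
    rcases le_total 0 (Real.cos α) with h6 | h6
    · have := mul_nonneg h4 h6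
      linarith
    · have h7 := mul_le_mul_of_nonpos_right h3 h6
      have h8 : -Real.cos α ≤ 1 := by linarith
      have h9 := mul_le_mul_of_nonneg_right h8 (abs_nonneg (x.2 : ℝ))
      nlinarith
  · exact absurd h hαπ.ne

end geometry

section walk

theorem measurableSet_past_stay {Ω : Type*} {ξ : ℕ → Ω → ℤ × ℤ} (E : Set (ℤ × ℤ)) (x : ℤ × ℤ)
    (n : ℕ) :
    MeasurableSet[⨆ s ∈ Finset.range (n + 1), MeasurableSpace.comap (ξ s) ⊤]
      {ω | ξ 0 ω = x ∧ ∀ i ≤ n, ξ i ω ∈ E} := by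
  have hcoord : ∀ i ≤ n, ∀ B : Set (ℤ × ℤ),
      MeasurableSet[⨆ s ∈ Finset.range (n + 1), MeasurableSpace.comap (ξ s) ⊤]
        {ω | ξ i ω ∈ B} := fun i hi B =>
    le_iSup₂_of_le (f := fun s (_ : s ∈ Finset.range (n + 1)) =>
      MeasurableSpace.comap (ξ s) ⊤) i (Finset.mem_range.2 (by omega)) le_rfl _ ⟨B, trivial, rfl⟩
  have e : {ω | ξ 0 ω = x ∧ ∀ i ≤ n, ξ i ω ∈ E} =
      {ω | ξ 0 ω ∈ ({x} : Set (ℤ × ℤ))} ∩ ⋂ i, ⋂ _ : i ≤ n, {ω | ξ i ω ∈ E} := by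
    ext ω; simp
  rw [e]
  exact (hcoord 0 (Nat.zero_le n) {x}).inter
    (MeasurableSet.iInter fun i => MeasurableSet.iInter fun hi => hcoord i hi E)

theorem lt_exitTime_iff {Ω : Type*} {ξ : ℕ → Ω → ℤ × ℤ} {W : Set (ℤ × ℤ)} {ω : Ω}
    {n : ℕ} :
    (n : ℝ≥0∞) < exitTime W ξ ω ↔ ∀ i ≤ n, ξ i ω ∈ W := by
  constructor
  · intro h i hi
    by_contra hW
    have : exitTime W ξ ω ≤ i := iInf₂_le i hW
    exact absurd (h.trans_le this) (not_lt.2 (by exact_mod_cast hi))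
  · intro h
    have : ((n + 1 : ℕ) : ℝ≥0∞) ≤ exitTime W ξ ω := by
      refine le_iInf₂ fun t ht => ?_
      have : n < t := by
        by_contra! hle
        exact ht (h t hle)
      exact_mod_cast this
    exact lt_of_lt_of_le (by exact_mod_cast n.lt_succ_self) this

variable {Ω : Type*} [MeasurableSpace Ω] {P : Measure Ω}

theorem setLIntegral_comp_eq_tsum {Y : Type*} [Countable Y] [MeasurableSpace Y]
    [MeasurableSingletonClass Y] {A : Set Ω} {η : Ω → Y} (hη : Measurable η) (g : Y → ℝ≥0∞) :
    ∫⁻ ω in A, g (η ω) ∂P = ∑' z, g z * P (A ∩ {ω | η ω = z}) := by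
  rw [← lintegral_map (measurable_of_countable g) hη, lintegral_countable']
  refine tsum_congr fun z => ?_
  rw [Measure.map_apply hη (measurableSet_singleton z),
    Measure.restrict_apply (hη (measurableSet_singleton z)), Set.inter_comm]
  rfl

variable {ξ : ℕ → Ω → ℤ × ℤ} {p : ℤ × ℤ → ℤ × ℤ → ℝ}

/-- The Markov property in integrated form. -/
theorem IsMarkovWith.setLIntegral_succ (hM : IsMarkovWith P ξ p)
    (hmeas : ∀ t, Measurable (ξ t)) (hp : ∀ x y, 0 ≤ p x y) {F : Finset (ℤ × ℤ)}
    (hpF : ∀ x y, y ∉ F → p x y = 0) {h : ℤ × ℤ → ℝ} (hh : ∀ z, 0 ≤ h z) {t : ℕ} {A : Set Ω}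
    (hA : MeasurableSet[⨆ s ∈ Finset.range (t + 1), MeasurableSpace.comap (ξ s) ⊤] A) :
    ∫⁻ ω in A, ENNReal.ofReal (h (ξ (t + 1) ω)) ∂P =
      ∫⁻ ω in A, ENNReal.ofReal (∑ y ∈ F, p (ξ t ω) y * h (ξ t ω + y)) ∂P := by
  have hη : Measurable fun ω => (ξ t ω, ξ (t + 1) ω - ξ t ω) :=
    (hmeas t).prodMk ((hmeas (t + 1)).sub (hmeas t))
  have e1 := setLIntegral_comp_eq_tsum (P := P) (A := A) hη
    fun zy => ENNReal.ofReal (h (zy.1 + zy.2))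
  simp only [add_sub_cancel] at e1
  rw [e1, ENNReal.tsum_prod',
    setLIntegral_comp_eq_tsum (hmeas t)
      (fun z => ENNReal.ofReal (∑ y ∈ F, p z y * h (z + y)))]
  refine tsum_congr fun z => ?_
  have e2 : ∀ y, A ∩ {ω | (ξ t ω, ξ (t + 1) ω - ξ t ω) = (z, y)} =
      A ∩ {ω | ξ t ω = z} ∩ {ω | ξ (t + 1) ω = z + y} := by
    intro y
    ext ω
    simp only [Set.mem_inter_iff, Set.mem_ofPred_eq, Prod.mk.injEq, and_assoc]
    refine and_congr_right fun _ => and_congr_right fun hz => ?_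
    rw [hz, sub_eq_iff_eq_add']
  simp only [e2, hM t z _ A hA]
  rw [tsum_eq_sum (s := F) fun y hy => by simp [hpF z y hy],
    ENNReal.ofReal_sum_of_nonneg fun y _ => mul_nonneg (hp z y) (hh _), Finset.sum_mul]
  refine Finset.sum_congr rfl fun y _ => ?_
  rw [ENNReal.ofReal_mul (hp z y)]
  ring

theorem IsMarkovWith.setLIntegral_stay (hM : IsMarkovWith P ξ p)
    (hmeas : ∀ t, Measurable (ξ t)) (hp : ∀ x y, 0 ≤ p x y) {F : Finset (ℤ × ℤ)}
    (hpF : ∀ x y, y ∉ F → p x y = 0) {E : Set (ℤ × ℤ)} {x : ℤ × ℤ} (hx : x ∈ E) (n : ℕ)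
    {h : ℤ × ℤ → ℝ} (hh : ∀ z, 0 ≤ h z) :
    ∫⁻ ω in {ω | ξ 0 ω = x ∧ ∀ i ≤ n, ξ i ω ∈ E}, ENNReal.ofReal (h (ξ n ω)) ∂P =
      P {ω | ξ 0 ω = x} * ENNReal.ofReal ((killedStep p F E ^ n) h x) := by
  induction n generalizing h with
  | zero =>
    have hms : MeasurableSet {ω | ξ 0 ω = x} := hmeas 0 (measurableSet_singleton x)
    have e : {ω | ξ 0 ω = x ∧ ∀ i ≤ 0, ξ i ω ∈ E} = {ω | ξ 0 ω = x} := by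
      ext ω
      simp only [Nat.le_zero, forall_eq, Set.mem_ofPred_eq, and_iff_left_iff_imp]
      rintro rfl
      exact hx
    rw [e, setLIntegral_congr_fun (g := fun _ => ENNReal.ofReal (h x)) hms
      (fun ω hω => by rw [show ξ 0 ω = x from hω]), setLIntegral_const, mul_comm]
    simp
  | succ n ih =>
    have hms : MeasurableSet {ω | ξ (n + 1) ω ∈ E} := hmeas (n + 1) .of_discrete
    have e : {ω | ξ 0 ω = x ∧ ∀ i ≤ n + 1, ξ i ω ∈ E} =
        {ω | ξ (n + 1) ω ∈ E} ∩ {ω | ξ 0 ω = x ∧ ∀ i ≤ n, ξ i ω ∈ E} := by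
      ext ω
      simp only [Set.mem_inter_iff, Set.mem_ofPred_eq, Nat.le_succ_iff, or_imp, forall_and,
        forall_eq]
      tauto
    have hind : ∀ z, 0 ≤ E.indicator h z := fun z => Set.indicator_nonneg (fun z _ => hh z) z
    have hind' : ∀ ω, {ω | ξ (n + 1) ω ∈ E}.indicator
        (fun ω => ENNReal.ofReal (h (ξ (n + 1) ω))) ω =
          ENNReal.ofReal (E.indicator h (ξ (n + 1) ω)) := by
      intro ω
      by_cases hω : ξ (n + 1) ω ∈ E
      · rw [Set.indicator_of_mem hω, Set.indicator_of_mem (s := {ω | ξ (n + 1) ω ∈ E}) hω]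
      · rw [Set.indicator_of_notMem hω,
          Set.indicator_of_notMem (s := {ω | ξ (n + 1) ω ∈ E}) hω, ENNReal.ofReal_zero]
    rw [e, ← setLIntegral_indicator hms]
    simp only [hind']
    rw [hM.setLIntegral_succ hmeas hp hpF hind (measurableSet_past_stay E x n), pow_succ,
      Module.End.mul_apply, ← ih (h := killedStep p F E h)
        fun z => Finset.sum_nonneg fun y _ => mul_nonneg (hp z y) (hind _)]
    rfl

theorem IsMarkovWith.measure_stay (hM : IsMarkovWith P ξ p)
    (hmeas : ∀ t, Measurable (ξ t)) (hp : ∀ x y, 0 ≤ p x y) {F : Finset (ℤ × ℤ)}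
    (hpF : ∀ x y, y ∉ F → p x y = 0) {E : Set (ℤ × ℤ)} {x : ℤ × ℤ} (hx : x ∈ E) (n : ℕ) :
    P {ω | ξ 0 ω = x ∧ ∀ i ≤ n, ξ i ω ∈ E} =
      P {ω | ξ 0 ω = x} * ENNReal.ofReal ((killedStep p F E ^ n) 1 x) := by
  rw [← hM.setLIntegral_stay hmeas hp hpF hx n (h := 1) fun _ => zero_le_one]
  simp

/-- The states visited by the walk with positive probability. -/
def visited (P : Measure Ω) (ξ : ℕ → Ω → ℤ × ℤ) : Set (ℤ × ℤ) :=
  {z | ∃ t, P {ω | ξ t ω = z} ≠ 0}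

theorem ae_mem_visited : ∀ᵐ ω ∂P, ∀ t, ξ t ω ∈ visited P ξ := by
  refine ae_all_iff.2 fun t => ?_
  refine measure_mono_null (t := ⋃ z ∈ (visited P ξ)ᶜ, {ω | ξ t ω = z})
    (fun ω hω => Set.mem_biUnion (show ξ t ω ∈ (visited P ξ)ᶜ from hω) rfl) ?_
  refine (measure_biUnion_null_iff (Set.to_countable _)).2 fun z hz => ?_
  by_contra h
  exact hz ⟨t, h⟩

theorem visited_subset {S : Set (ℤ × ℤ)} (hinS : ∀ t, ∀ᵐ ω ∂P, ξ t ω ∈ S) :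
    visited P ξ ⊆ S := by
  rintro z ⟨t, ht⟩
  by_contra hz
  refine ht (measure_mono_null ?_ (hinS t))
  rintro ω rfl
  exact hz

theorem IsMarkovWith.ae_jump_pos (hM : IsMarkovWith P ξ p) :
    ∀ᵐ ω ∂P, ∀ t, 0 < p (ξ t ω) (ξ (t + 1) ω - ξ t ω) := by
  refine ae_all_iff.2 fun t => ?_
  refine measure_mono_null (t := ⋃ zy ∈ {zy : (ℤ × ℤ) × (ℤ × ℤ) | p zy.1 zy.2 ≤ 0},
    {ω | ξ t ω = zy.1} ∩ {ω | ξ (t + 1) ω = zy.1 + zy.2}) (fun ω hω => ?_) ?_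
  · refine Set.mem_biUnion (x := (ξ t ω, ξ (t + 1) ω - ξ t ω))
      (show p (ξ t ω) (ξ (t + 1) ω - ξ t ω) ≤ 0 from not_lt.1 hω) ⟨rfl, ?_⟩
    simp
  · refine (measure_biUnion_null_iff (Set.to_countable _)).2 fun zy hzy => ?_
    have := hM t zy.1 zy.2 Set.univ .univ
    rwa [Set.univ_inter, ENNReal.ofReal_of_nonpos hzy, zero_mul] at this

/-- Under `A1`, from each visited state there is a path of positive-probability jumps, of length
`n₀`, realising each of the four displacements. -/
theorem IsMarkovWith.exists_path (hM : IsMarkovWith P ξ p) {S : Set (ℤ × ℤ)}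
    (hinS : ∀ t, ∀ᵐ ω ∂P, ξ t ω ∈ S) {κ : ℝ} {k n₀ : ℕ} (hκ : 0 < κ)
    (hA1 : A1 P S ξ κ k n₀) {z y : ℤ × ℤ} (hz : z ∈ visited P ξ)
    (hy : y ∈ ({((k : ℤ), (0 : ℤ)), (-(k : ℤ), 0), (0, (k : ℤ)), (0, -(k : ℤ))} :
      Set (ℤ × ℤ))) :
    ∃ γ : ℕ → ℤ × ℤ, γ 0 = z ∧ γ n₀ = z + y ∧ (∀ i, γ i ∈ visited P ξ) ∧
      ∀ i, 0 < p (γ i) (γ (i + 1) - γ i) := by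
  obtain ⟨t, ht⟩ := hz
  have hpos : P ({ω | ξ t ω = z} ∩ {ω | ξ (t + n₀) ω = z + y}) ≠ 0 := by
    refine (lt_of_lt_of_le ?_ (hA1 t z (visited_subset hinS ⟨t, ht⟩) y hy)).ne'
    exact ENNReal.mul_pos (ENNReal.ofReal_pos.2 hκ).ne' ht
  have hex : ∃ᵐ ω ∂P, ω ∈ {ω | ξ t ω = z} ∩ {ω | ξ (t + n₀) ω = z + y} :=
    frequently_ae_mem_iff.2 hpos
  obtain ⟨ω, ⟨h1, h2⟩, h3, h4⟩ := (hex.and_eventually (ae_mem_visited.and hM.ae_jump_pos)).exists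
  exact ⟨fun i => ξ (t + i) ω, h1, h2, fun i => h3 (t + i), fun i => h4 (t + i)⟩

theorem reflTransGen_path {r : ℤ × ℤ → ℤ × ℤ → Prop} {γ : ℕ → ℤ × ℤ}
    (h : ∀ i, r (γ i) (γ (i + 1))) (n : ℕ) : Relation.ReflTransGen r (γ 0) (γ n) := by
  induction n with
  | zero => exact .refl
  | succ n ih => exact ih.tail (h n)

theorem IsMarkovWith.exists_reachable_sub (hM : IsMarkovWith P ξ p) {S : Set (ℤ × ℤ)}
    (hinS : ∀ t, ∀ᵐ ω ∂P, ξ t ω ∈ S) {κ : ℝ} {k n₀ : ℕ} (hκ : 0 < κ)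
    (hA1 : A1 P S ξ κ k n₀) {x : ℤ × ℤ} (hx : x ∈ visited P ξ) (m : ℕ) :
    x - ((m * k : ℤ), 0) ∈ visited P ξ ∧
      Relation.ReflTransGen (fun a c => 0 < p a (c - a)) x (x - ((m * k : ℤ), 0)) := by
  induction m with
  | zero =>
    have : x - (((0 : ℕ) * k : ℤ), 0) = x := by ext <;> simp
    rw [this]
    exact ⟨hx, .refl⟩
  | succ m ih =>
    obtain ⟨γ, h0, hn, hv, hj⟩ := hM.exists_path hinS hκ hA1 ih.1 (y := (-(k : ℤ), 0)) (by simp)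
    have e : x - (((m + 1 : ℕ) * k : ℤ), 0) = γ n₀ := by
      rw [hn]; ext <;> simp; ring
    rw [e]
    refine ⟨hv _, ih.2.trans ?_⟩
    rw [← h0]
    exact reflTransGen_path hj n₀

/-- Above (or below) the slit, bounded jumps cannot cross it, so without exit every vertical
translate towards the slit is reachable and stays on the same side. -/
theorem IsMarkovWith.forall_reachable_of_not_exit (hM : IsMarkovWith P ξ p) {S : Set (ℤ × ℤ)}
    (hinS : ∀ t, ∀ᵐ ω ∂P, ξ t ω ∈ S) {κ : ℝ} {k n₀ : ℕ} (hκ : 0 < κ)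
    (hA1 : A1 P S ξ κ k n₀) {b : ℝ} (hA2 : A2 p b) {s : ℤ} (hs : s = 1 ∨ s = -1)
    {x : ℤ × ℤ} (hx : x ∈ visited P ξ) (hx1 : (x.1 : ℝ) ≤ -(n₀ * b)) (hx2 : b < s * x.2)
    (hstay : ∀ z, Relation.ReflTransGen (fun a c => 0 < p a (c - a)) x z →
      z ∈ Wset b Real.pi) (m : ℕ) :
    x - (0, s * (m * k : ℤ)) ∈ visited P ξ ∧
      Relation.ReflTransGen (fun a c => 0 < p a (c - a)) x (x - (0, s * (m * k : ℤ))) ∧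
      b < s * (x.2 - s * (m * k : ℤ)) := by
  induction m with
  | zero =>
    have : x - ((0 : ℤ), s * ((0 : ℕ) * k : ℤ)) = x := by ext <;> simp
    rw [this]
    exact ⟨hx, .refl, by simpa using hx2⟩
  | succ m ih =>
    obtain ⟨ihv, ihr, ihb⟩ := ih
    obtain ⟨γ, h0, hn, hv, hj⟩ := hM.exists_path hinS hκ hA1 ihv (y := (0, -(s * k : ℤ)))
      (by rcases hs with rfl | rfl <;> simp)
    have e : x - ((0 : ℤ), s * ((m + 1 : ℕ) * k : ℤ)) = γ n₀ := by
      rw [hn]; ext <;> simp; ring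
    have hr : ∀ i, Relation.ReflTransGen (fun a c => 0 < p a (c - a)) x (γ i) := fun i =>
      ihr.trans (h0 ▸ reflTransGen_path hj i)
    have hjump : ∀ i, znorm (γ (i + 1) - γ i) ≤ b := by
      intro i
      by_contra! hlt
      exact (hj i).ne' (hA2 _ _ hlt)
    have hfst : ∀ i : ℕ, ((γ i).1 : ℝ) ≤ x.1 + i * b := by
      intro i
      induction i with
      | zero => rw [h0]; simp
      | succ i ihi =>
        have h1 := (le_abs_self _).trans ((abs_fst_le_znorm _).trans (hjump i))
        rw [Prod.fst_sub, Int.cast_sub] at h1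
        push_cast
        linarith
    have hb : 0 ≤ b := (znorm_nonneg _).trans (hjump 0)
    have hsnd : ∀ i : ℕ, i ≤ n₀ → b < s * (γ i).2 := by
      intro i
      induction i with
      | zero => intro _; rw [h0]; simpa using ihb
      | succ i ihi =>
        intro hi
        have h1 := ihi (by omega)
        have h2 := abs_le.1 ((abs_snd_le_znorm _).trans (hjump i))
        rw [Prod.snd_sub, Int.cast_sub] at h2
        have h3 : ((γ (i + 1)).1 : ℝ) ≤ 0 := by
          have h4 : ((i + 1 : ℕ) : ℝ) * b ≤ n₀ * b := by gcongr
          linarith [hfst (i + 1)]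
        rcases hstay _ (hr (i + 1)) with ⟨h, _⟩ | ⟨_, h⟩
        · exact absurd h (lt_irrefl _)
        · by_contra! hle
          refine h ⟨h3, abs_le.2 ?_⟩
          rcases hs with rfl | rfl <;> push_cast at h1 hle ⊢ <;> constructor <;>
            linarith [h2.1, h2.2]
    refine ⟨e ▸ hv n₀, e ▸ hr n₀, ?_⟩
    have h1 := hsnd n₀ le_rfl
    rw [← e] at h1
    simpa using h1

theorem IsMarkovWith.exists_reachable_exit (hM : IsMarkovWith P ξ p) {S : Set (ℤ × ℤ)}
    (hinS : ∀ t, ∀ᵐ ω ∂P, ξ t ω ∈ S) {κ : ℝ} {k n₀ : ℕ} (hκ : 0 < κ) (hk : 0 < k)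
    (hA1 : A1 P S ξ κ k n₀) {b : ℝ} (hA2 : A2 p b) (hb : 0 < b) {α : ℝ} (hα : 0 < α)
    (hαπ : α ≤ Real.pi) {x : ℤ × ℤ} (hx : x ∈ visited P ξ) :
    ∃ z, z ∉ Wset b α ∧ Relation.ReflTransGen (fun a c => 0 < p a (c - a)) x z := by
  rcases hαπ.lt_or_eq with hlt | rfl
  · obtain ⟨m, hm⟩ := exists_sub_notMem_Wset (b := b) hα hlt hk x
    exact ⟨_, hm, (hM.exists_reachable_sub hinS hκ hA1 hx m).2⟩
  · by_contra! hcon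
    have hstay : ∀ z, Relation.ReflTransGen (fun a c => 0 < p a (c - a)) x z →
        z ∈ Wset b Real.pi := fun z hz => by
      by_contra h
      exact hcon z h hz
    have hk' : (1 : ℝ) ≤ k := by exact_mod_cast hk
    obtain ⟨m, hm⟩ := exists_nat_gt ((x.1 : ℝ) + n₀ * b)
    obtain ⟨hv, hr⟩ := hM.exists_reachable_sub hinS hκ hA1 hx m
    set z := x - ((m * k : ℤ), 0) with hz
    have hz1 : (z.1 : ℝ) ≤ -(n₀ * b) := by
      have : (m : ℝ) ≤ m * k := le_mul_of_one_le_right (by positivity) hk'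
      rw [hz, Prod.fst_sub]
      push_cast
      linarith
    have hz0 : (z.1 : ℝ) ≤ 0 := hz1.trans (neg_nonpos.2 (by positivity))
    obtain ⟨s, hs, hzs⟩ : ∃ s : ℤ, (s = 1 ∨ s = -1) ∧ b < s * z.2 := by
      rcases hstay z hr with ⟨h, _⟩ | ⟨_, h⟩
      · exact absurd h (lt_irrefl _)
      · have h2 : b < |(z.2 : ℝ)| := by
          by_contra! hle
          exact h ⟨hz0, hle⟩
        rcases lt_abs.1 h2 with h3 | h3
        · exact ⟨1, .inl rfl, by simpa using h3⟩
        · exact ⟨-1, .inr rfl, by simpa using h3⟩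
    obtain ⟨j, hj⟩ := exists_nat_gt ((s : ℝ) * z.2)
    obtain ⟨-, -, h⟩ := hM.forall_reachable_of_not_exit hinS hκ hA1 hA2 hs hv hz1 hzs
      (fun y hy => hstay y (hr.trans hy)) j
    have h1 : (j : ℝ) ≤ j * k := le_mul_of_one_le_right (by positivity) hk'
    have hss : (s : ℝ) * s = 1 := by rcases hs with rfl | rfl <;> norm_num
    push_cast at h
    have h2 : (s : ℝ) * (z.2 - s * (j * k)) = s * z.2 - j * k := by
      linear_combination -((j : ℝ) * k) * hss
    linarith

end walk

/-- Lemma 5.1: under (A1) and (A2), if the process `f_w(ξ)^{2p₀/w}`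
has uniformly negative drift `≤ -C f_w(x)^{(2p₀-2)/w}` on `W(α)` far from the origin,
then `E[τ_α^p ∣ ξ₀ = x] < ∞` for every `p ∈ [0,p₀)` and every `x ∈ W(α)`. -/
theorem exit_time_moments_from_lyapunov_drift
    {Ω : Type*} [MeasurableSpace Ω] (P : Measure Ω) [IsProbabilityMeasure P]
    (S : Set (ℤ × ℤ)) (hSunb : ∀ R : ℝ, ∃ x ∈ S, R < znorm x)
    (ξ : ℕ → Ω → ℤ × ℤ) (hmeas : ∀ t, Measurable (ξ t))
    (hinS : ∀ t, ∀ᵐ ω ∂P, ξ t ω ∈ S)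
    (p : ℤ × ℤ → ℤ × ℤ → ℝ) (hpmf : IsJumpPMF p)
    (hMarkov : IsMarkovWith P ξ p)
    (κ : ℝ) (k n₀ : ℕ) (hκ : 0 < κ) (hk : 0 < k) (hn₀ : 0 < n₀)
    (hA1 : A1 P S ξ κ k n₀)
    (b : ℝ) (hb : 0 < b) (hA2 : A2 p b)
    (α w : ℝ) (hα0 : 0 < α) (hαπ : α ≤ Real.pi)
    (hw0 : 0 < w) (hw : w < Real.pi / (2 * α))
    (p₀ A₀ C : ℝ) (hp₀ : 0 < p₀) (hA₀ : 0 < A₀) (hC : 0 < C)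
    (hdrift : ∀ x : ℤ × ℤ, x ∈ Wset b α → x ∈ S → A₀ ≤ znorm x →
      (∑' y : ℤ × ℤ, p x y * (fw w (x + y) ^ (2 * p₀ / w) - fw w x ^ (2 * p₀ / w))) ≤
        -C * fw w x ^ ((2 * p₀ - 2) / w)) :
    ∀ q : ℝ, 0 ≤ q → q < p₀ → ∀ x ∈ Wset b α,
      ∫⁻ ω in {ω | ξ 0 ω = x}, exitTime (Wset b α) ξ ω ^ q ∂P < ⊤ := by
  intro q hq0 hqp x hxW
  obtain ⟨hp, hsum⟩ := hpmf
  set W := Wset b α with hWdef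
  by_cases hx0 : P {ω | ξ 0 ω = x} = 0
  · rw [setLIntegral_measure_zero _ _ hx0]; exact ENNReal.zero_lt_top
  have hwα : w * α < Real.pi / 2 := by
    rw [lt_div_iff₀ (by positivity)] at hw; linarith
  have hcos : 0 < Real.cos (w * α) :=
    Real.cos_pos_of_mem_Ioo ⟨by linarith [mul_pos hw0 hα0, Real.pi_pos], hwα⟩
  set F : Finset (ℤ × ℤ) := (finite_znorm_le b).toFinset with hF
  have hpF : ∀ x y, y ∉ F → p x y = 0 := fun x y hy =>
    hA2 x y (not_le.1 fun h => hy ((finite_znorm_le b).mem_toFinset.2 h))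
  have hFsum : ∀ x, ∑ y ∈ F, p x y = 1 := fun x => by
    rw [← (hsum x).tsum_eq, tsum_eq_sum (s := F) fun y hy => hpF x y hy]
  have hFb : ∀ y ∈ F, znorm y ≤ b := fun y hy => (finite_znorm_le b).mem_toFinset.1 hy
  set E : Set (ℤ × ℤ) := W ∩ visited P ξ with hE
  have hxE : x ∈ E := ⟨hxW, 0, hx0⟩
  obtain ⟨A, hA⟩ := exists_forall_fw_add_nonneg hb hα0 hw0 hwα
  set A' := max (max A A₀) 1 with hA'
  set K : Set (ℤ × ℤ) := {z ∈ E | znorm z ≤ A'} with hK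
  have hfw : ∀ z ∈ E, 0 ≤ fw w z := fun z hz =>
    le_trans (mul_nonneg (Real.rpow_nonneg (znorm_nonneg z) _) hcos.le)
      (znorm_rpow_mul_cos_le_fw hb hα0 hw0 hwα hz.1)
  have hfar : ∀ z ∈ E, z ∉ K → A' ≤ znorm z := fun z hz hzK =>
    (not_le.1 fun h => hzK ⟨hz, h⟩).le
  set V : ℤ × ℤ → ℝ := fun z => fw w z ^ (2 * p₀ / w) with hV
  have hγ : 0 < 2 * p₀ / w := by positivity
  obtain ⟨D, hD⟩ := exists_tail_le_of_drift_off_finite (T := killedStep p F E) (E := E)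
    (killedStep_mono hp) (killedStep_one_le hp hFsum) (V := V) (c := C)
    (v := Real.cos (w * α) ^ (2 * p₀ / w)) hp₀ hC (by positivity) (K := K)
    ((finite_znorm_le A').subset fun z hz => hz.2) (fun z hz => hz.1)
    (fun z hz => by
      obtain ⟨y, hy, hzy⟩ := hMarkov.exists_reachable_exit hinS hκ hk hA1 hA2 hb hα0 hαπ hz.1.2
      exact exists_killedStep_pow_one_lt_one hp hFsum hpF (fun h => hy h.1) hzy hz.1)
    (fun z hz => Real.rpow_nonneg (hfw z hz) _)
    (fun z hz hzK => by
      refine Real.rpow_le_rpow hcos.le (le_trans ?_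
        (znorm_rpow_mul_cos_le_fw hb hα0 hw0 hwα hz.1)) hγ.le
      refine le_mul_of_one_le_left hcos.le (Real.one_le_rpow ?_ hw0.le)
      exact (le_max_right _ _).trans (hfar z hz hzK))
    (fun z hz hzK => by
      have hzA := hfar z hz hzK
      have h1 := hdrift z hz.1 (visited_subset hinS hz.2)
        (((le_max_right _ _).trans (le_max_left _ _)).trans hzA)
      rw [tsum_eq_sum (s := F) fun y hy => by rw [hpF z y hy, zero_mul]] at h1
      have h2 : killedStep p F E V z ≤ ∑ y ∈ F, p z y * V (z + y) := by
        rw [killedStep_apply]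
        refine Finset.sum_le_sum fun y hy => mul_le_mul_of_nonneg_left ?_ (hp z y)
        refine Set.indicator_apply_le' (fun _ => le_rfl) fun _ => Real.rpow_nonneg ?_ _
        exact hA z hz.1 (((le_max_left _ _).trans (le_max_left _ _)).trans hzA) y (hFb y hy)
      have h3 : ∑ y ∈ F, p z y * V (z + y) =
          ∑ y ∈ F, p z y * (fw w (z + y) ^ (2 * p₀ / w) - fw w z ^ (2 * p₀ / w)) + V z := by
        simp only [mul_sub, Finset.sum_sub_distrib, ← Finset.sum_mul, hFsum, one_mul, hV]
        ring
      have h4 : V z ^ (1 - 1 / p₀) = fw w z ^ ((2 * p₀ - 2) / w) := by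
        simp only [hV]
        rw [← Real.rpow_mul (hfw z hz)]
        congr 1
        field_simp
      rw [h4]
      linarith) hxE
  have hτ : ∀ n : ℕ, MeasurableSet {ω | (n : ℝ≥0∞) < exitTime W ξ ω} := fun n => by
    have e : {ω | (n : ℝ≥0∞) < exitTime W ξ ω} = ⋂ i, ⋂ _ : i ≤ n, {ω | ξ i ω ∈ W} := by
      ext ω; simp [lt_exitTime_iff]
    rw [e]
    exact .iInter fun i => .iInter fun _ => hmeas i .of_discrete
  refine lintegral_rpow_lt_top_of_tail_le hτ (D := D) hq0 hqp fun n hn => ?_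
  rw [Measure.restrict_apply (hτ n)]
  calc P ({ω | (n : ℝ≥0∞) < exitTime W ξ ω} ∩ {ω | ξ 0 ω = x})
      ≤ P {ω | ξ 0 ω = x ∧ ∀ i ≤ n, ξ i ω ∈ E} := by
        refine measure_mono_ae ?_
        filter_upwards [ae_mem_visited (P := P) (ξ := ξ)] with ω hω h
        exact ⟨h.2, fun i hi => ⟨lt_exitTime_iff.1 h.1 i hi, hω i⟩⟩
    _ = P {ω | ξ 0 ω = x} * ENNReal.ofReal ((killedStep p F E ^ n) 1 x) :=
        hMarkov.measure_stay hmeas hp hpF hxE n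
    _ ≤ ENNReal.ofReal (D * (n : ℝ) ^ (-p₀)) :=
        (mul_le_of_le_one_left' prob_le_one).trans (ENNReal.ofReal_le_ofReal (hD n hn))
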